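/- Let (u_p)_{p>1} be a family of nodal solutions of (𝒫_p) satisfying condition (A), and let NL_p := {x ∈ Ω : u_p(x) = 0} be the nodal set of u_p. Then dist(x_p⁺, NL_p)/ε_p → +∞ as p → +∞. -/

import Mathlib

open MeasureTheory Real Set Filter Topology Metric

noncomputable section

/-- The Euclidean plane. -/
abbrev R2 : Type := EuclideanSpace ℝ (Fin 2)

/-- The Laplacian: sum of the two pure second directional derivatives. -/
def lap (u : R2 → ℝ) (x : R2) : ℝ :=
  ∑ i : Fin 2,
    fderiv ℝ (fun y => fderiv ℝ u y (EuclideanSpace.single i 1)) x (EuclideanSpace.single i 1)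

/-- Each point of ∂Ω has a neighborhood in which ∂Ω is the graph of a C^∞ function
(in suitable Euclidean coordinates). -/
def SmoothBoundary (Ω : Set R2) : Prop :=
  ∀ x ∈ frontier Ω, ∃ V : Set R2, IsOpen V ∧ x ∈ V ∧
    ∃ (e : R2 ≃ᵢ R2) (g : ℝ → ℝ), ContDiff ℝ (⊤ : ℕ∞) g ∧
      frontier Ω ∩ V = {y | y ∈ V ∧ e y 1 = g (e y 0)}

/-- A (classical) solution of the Lane–Emden problem `(𝒫_p)` on Ω. -/
def IsSolution (Ω : Set R2) (p : ℝ) (u : R2 → ℝ) : Prop :=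
  ContDiffOn ℝ 2 u Ω ∧ ContDiffOn ℝ 1 u (closure Ω) ∧
  (∀ x ∈ Ω, -lap u x = |u x| ^ (p - 1) * u x) ∧
  (∀ x ∈ frontier Ω, u x = 0)

/-- A nodal (sign-changing) function on Ω. -/
def IsNodal (Ω : Set R2) (u : R2 → ℝ) : Prop :=
  (∃ x ∈ Ω, 0 < u x) ∧ ∃ x ∈ Ω, u x < 0

/-- The energy functional E_p. -/
def energy (Ω : Set R2) (p : ℝ) (u : R2 → ℝ) : ℝ :=
  (1 / 2) * ∫ x in Ω, ‖gradient u x‖ ^ 2 - (1 / (p + 1)) * ∫ x in Ω, |u x| ^ (p + 1)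

/-- Condition (A): p·∫_Ω |∇u_p|² → 16πe. -/
def CondA (Ω : Set R2) (u : ℝ → R2 → ℝ) : Prop :=
  Tendsto (fun p : ℝ => p * ∫ x in Ω, ‖gradient (u p) x‖ ^ 2) atTop
    (𝓝 (16 * π * Real.exp 1))

/-- Condition (B): p·(u_p(x_p⁺) + u_p(x_p⁻)) → K for some K ≥ 0. -/
def CondB (u : ℝ → R2 → ℝ) (xp xm : ℝ → R2) : Prop :=
  ∃ K : ℝ, 0 ≤ K ∧ Tendsto (fun p : ℝ => p * (u p (xp p) + u p (xm p))) atTop (𝓝 K)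

/-- ε_p := (p·u_p(x_p⁺)^{p−1})^{−1/2}. -/
def eps (u : ℝ → R2 → ℝ) (xp : ℝ → R2) (p : ℝ) : ℝ :=
  1 / Real.sqrt (p * u p (xp p) ^ (p - 1))

/-- The rescaling z_p of u_p around x_p⁺. -/
def zp (u : ℝ → R2 → ℝ) (xp : ℝ → R2) (p : ℝ) (x : R2) : ℝ :=
  (p / u p (xp p)) * (u p (eps u xp p • x + xp p) - u p (xp p))

/-- The rescaling z_p⁻ of u_p around x_p⁻ (with the scale ε_p of the maximum). -/
def zm (u : ℝ → R2 → ℝ) (xp xm : ℝ → R2) (p : ℝ) (x : R2) : ℝ :=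
  (p / u p (xp p)) * (-u p (eps u xp p • x + xm p) - u p (xp p))

/-- Convergence in C²_loc(ℝ²) of a family of functions f_i defined on sets D_i:
every compact set K is eventually contained in D_i, and on K all derivatives up to
order 2 converge uniformly. -/
def TendstoC2loc {ι : Type} (l : Filter ι) (D : ι → Set R2) (f : ι → R2 → ℝ)
    (g : R2 → ℝ) : Prop :=
  ∀ K : Set R2, IsCompact K →
    (∀ᶠ i in l, K ⊆ D i) ∧
    ∀ n : ℕ, n ≤ 2 →
      TendstoUniformlyOn (fun i x => iteratedFDeriv ℝ n (f i) x)
        (fun x => iteratedFDeriv ℝ n g x) l K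

/-- The standard bubble U(x) = −2 log(1 + |x|²/8). -/
def stdBubble (x : R2) : ℝ := -2 * Real.log (1 + ‖x‖ ^ 2 / 8)

/-- The bubble U_μ(x) = log(μ/(1 + μ|x|²/8)²). -/
def bubble (μ : ℝ) (x : R2) : ℝ := Real.log (μ / (1 + μ * ‖x‖ ^ 2 / 8) ^ 2)

/-- A C^∞ function compactly supported in S. -/
def CcSmoothIn (S : Set R2) (v : R2 → ℝ) : Prop :=
  ContDiff ℝ (⊤ : ℕ∞) v ∧ HasCompactSupport v ∧ tsupport v ⊆ S

/-- The quadratic form of the linearized operator at u. -/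
def Qform (p : ℝ) (u v : R2 → ℝ) : ℝ :=
  ∫ x, (‖gradient v x‖ ^ 2 - p * |u x| ^ (p - 1) * v x ^ 2)

/-- Morse index one hypothesis (M): for p large, the quadratic form of the linearized
operator is negative somewhere on C_c^∞ of the positive nodal domain, but is not
negative definite on any 2-dimensional subspace. -/
def MorseOne (Ω : Set R2) (u : ℝ → R2 → ℝ) : Prop :=
  ∀ᶠ p : ℝ in atTop,
    (∃ v : R2 → ℝ, CcSmoothIn {x ∈ Ω | 0 < u p x} v ∧ Qform p (u p) v < 0) ∧
    ¬ ∃ v w : R2 → ℝ, CcSmoothIn {x ∈ Ω | 0 < u p x} v ∧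
        CcSmoothIn {x ∈ Ω | 0 < u p x} w ∧
        LinearIndependent ℝ ![v, w] ∧
        ∀ a b : ℝ, ¬(a = 0 ∧ b = 0) →
          Qform p (u p) (fun x => a * v x + b * w x) < 0

lemma hasDerivAt_max_zero_pow (n : ℕ) (s : ℝ) :
    HasDerivAt (fun s : ℝ => max s 0 ^ (n + 2)) ((n + 2) * max s 0 ^ (n + 1)) s := by
  rcases lt_trichotomy s 0 with hs | hs | hs
  · have h : (fun s : ℝ => max s 0 ^ (n + 2)) =ᶠ[𝓝 s] fun _ => 0 := by
      filter_upwards [Iio_mem_nhds hs] with t ht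
      simp [max_eq_right (le_of_lt (mem_Iio.1 ht))]
    rw [max_eq_right hs.le]
    simpa using (hasDerivAt_const s (0 : ℝ)).congr_of_eventuallyEq h
  · subst hs
    have h : (fun s : ℝ => max s 0 ^ (n + 2)) =o[𝓝 0] fun s : ℝ => s := by
      have h1 : (fun s : ℝ => max s 0 ^ (n + 2)) =O[𝓝 0] fun s : ℝ => s ^ (n + 2) := by
        refine Asymptotics.IsBigO.of_bound 1 (Eventually.of_forall fun t => ?_)
        rw [one_mul, norm_pow, norm_pow]
        refine pow_le_pow_left₀ (norm_nonneg _) ?_ _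
        rw [Real.norm_eq_abs, Real.norm_eq_abs, abs_of_nonneg (le_max_right _ _)]
        exact max_le (le_abs_self t) (abs_nonneg t)
      refine h1.trans_isLittleO ?_
      simpa using Asymptotics.isLittleO_pow_pow (𝕜 := ℝ) (m := 1) (n := n + 2) (by omega)
    rw [hasDerivAt_iff_isLittleO]
    simpa using h
  · have h : (fun s : ℝ => max s 0 ^ (n + 2)) =ᶠ[𝓝 s] fun s => s ^ (n + 2) := by
      filter_upwards [Ioi_mem_nhds hs] with t ht
      simp [max_eq_left (le_of_lt (mem_Ioi.1 ht))]
    rw [max_eq_left hs.le]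
    simpa using (hasDerivAt_pow (n + 2) s).congr_of_eventuallyEq h

lemma contDiff_max_zero_pow (n : ℕ) : ContDiff ℝ n (fun s : ℝ => max s 0 ^ (n + 1)) := by
  induction n with
  | zero =>
    rw [Nat.cast_zero, contDiff_zero]
    fun_prop
  | succ n ih =>
    have hd : deriv (fun s : ℝ => max s 0 ^ (n + 2)) = fun s : ℝ => ((n : ℝ) + 2) * max s 0 ^ (n + 1) :=
      funext fun s => (hasDerivAt_max_zero_pow n s).deriv
    rw [Nat.cast_succ, contDiff_succ_iff_deriv]
    refine ⟨fun s => (hasDerivAt_max_zero_pow n s).differentiableAt, by simp, ?_⟩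
    rw [hd]
    exact contDiff_const.mul ih

/-- The radial weight `(1 - |z|²)₊²`. -/
def wt (z : R2) : ℝ := max (1 - ‖z‖ ^ 2) 0 ^ 2

/-- The radial potential `(1 - |z|²)₊³ / 6`, whose gradient is `-wt z • z`. -/
def wtPot (z : R2) : ℝ := max (1 - ‖z‖ ^ 2) 0 ^ 3 / 6

lemma wt_nonneg (z : R2) : 0 ≤ wt z := sq_nonneg _

lemma wtPot_nonneg (z : R2) : 0 ≤ wtPot z := by unfold wtPot; positivity

lemma continuous_wt : Continuous wt := by unfold wt; fun_prop

lemma wt_eq_zero {z : R2} (hz : 1 ≤ ‖z‖) : wt z = 0 := by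
  have : 1 - ‖z‖ ^ 2 ≤ 0 := by nlinarith
  simp [wt, max_eq_right this]

lemma wtPot_eq_zero {z : R2} (hz : 1 ≤ ‖z‖) : wtPot z = 0 := by
  have : 1 - ‖z‖ ^ 2 ≤ 0 := by nlinarith
  simp [wtPot, max_eq_right this]

lemma wt_le_one (z : R2) : wt z ≤ 1 := by
  have h : max (1 - ‖z‖ ^ 2) 0 ≤ 1 := max_le (by nlinarith [sq_nonneg ‖z‖]) zero_le_one
  exact pow_le_one₀ (le_max_right _ _) h

lemma wtPot_le_wt (z : R2) : wtPot z ≤ wt z := by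
  have h : max (1 - ‖z‖ ^ 2) 0 ≤ 1 := max_le (by nlinarith [sq_nonneg ‖z‖]) zero_le_one
  have h0 : 0 ≤ max (1 - ‖z‖ ^ 2) 0 := le_max_right _ _
  unfold wt wtPot
  nlinarith [sq_nonneg (max (1 - ‖z‖ ^ 2) 0), mul_nonneg (sq_nonneg (max (1 - ‖z‖ ^ 2) 0)) h0,
    mul_nonneg (sq_nonneg (max (1 - ‖z‖ ^ 2) 0)) (sub_nonneg.2 h)]

lemma le_wt {z : R2} (hz : ‖z‖ ≤ 1 / 2) : 9 / 16 ≤ wt z := by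
  have h : 3 / 4 ≤ max (1 - ‖z‖ ^ 2) 0 :=
    le_max_of_le_left (by nlinarith [norm_nonneg z])
  unfold wt
  nlinarith

lemma hasCompactSupport_wt : HasCompactSupport wt :=
  HasCompactSupport.intro (isCompact_closedBall (0 : R2) 1) fun z hz => wt_eq_zero (by
    simp only [mem_closedBall, dist_zero_right, not_le] at hz
    exact hz.le)

lemma hasCompactSupport_wtPot : HasCompactSupport wtPot :=
  HasCompactSupport.intro (isCompact_closedBall (0 : R2) 1) fun z hz => wtPot_eq_zero (by
    simp only [mem_closedBall, dist_zero_right, not_le] at hz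
    exact hz.le)

lemma continuous_wtPot : Continuous wtPot := by unfold wtPot; fun_prop

lemma integrable_mul_wt {f : R2 → ℝ} (hf : Continuous f) : Integrable (fun z => f z * wt z) :=
  (hf.mul continuous_wt).integrable_of_hasCompactSupport hasCompactSupport_wt.mul_left

lemma integrable_mul_wtPot {f : R2 → ℝ} (hf : Continuous f) :
    Integrable (fun z => f z * wtPot z) :=
  (hf.mul continuous_wtPot).integrable_of_hasCompactSupport hasCompactSupport_wtPot.mul_left

lemma integrable_wt : Integrable wt :=
  continuous_wt.integrable_of_hasCompactSupport hasCompactSupport_wt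

lemma hasFDerivAt_wtPot (z : R2) : HasFDerivAt wtPot (-(wt z) • innerSL ℝ z) z := by
  have h1 : HasFDerivAt (fun z : R2 => 1 - ‖z‖ ^ 2) (-((2 : ℝ) • innerSL ℝ z)) z := by
    simpa [two_smul] using ((hasStrictFDerivAt_norm_sq z).hasFDerivAt).const_sub 1
  have h2 := ((hasDerivAt_max_zero_pow 1 (1 - ‖z‖ ^ 2)).comp_hasFDerivAt z h1).const_mul (1 / 6)
  refine (h2.congr_fderiv ?_).congr_of_eventuallyEq
    (Eventually.of_forall fun z => by simp [wtPot]; ring)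
  ext w
  simp [wt]
  ring

lemma fderiv_wtPot_single (z : R2) (i : Fin 2) :
    fderiv ℝ wtPot z (EuclideanSpace.single i 1) = -(wt z * z i) := by
  rw [(hasFDerivAt_wtPot z).fderiv]
  simp [EuclideanSpace.inner_single_right]

lemma integral_wt_pos : 0 < ∫ z, wt z := by
  refine continuous_wt.integral_pos_of_hasCompactSupport_nonneg_nonzero hasCompactSupport_wt
    (fun z => wt_nonneg z) (x := 0) ?_
  simp [wt]

lemma eq_sum_single (z : R2) : z = ∑ i : Fin 2, z i • EuclideanSpace.single i (1 : ℝ) := by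
  ext j
  fin_cases j <;> simp

lemma contDiff_fderiv_single {v : R2 → ℝ} (hv : ContDiff ℝ 2 v) (i : Fin 2) :
    ContDiff ℝ 1 fun y => fderiv ℝ v y (EuclideanSpace.single i 1) :=
  (hv.fderiv_right (m := 1) (by norm_num)).clm_apply contDiff_const

lemma continuous_lap {v : R2 → ℝ} (hv : ContDiff ℝ 2 v) : Continuous (lap v) := by
  unfold lap
  refine continuous_finsetSum _ fun i _ => ?_
  exact ((contDiff_fderiv_single hv i).continuous_fderiv (by norm_num)).clm_apply
    continuous_const

lemma integral_fderiv_mul_wt {v : R2 → ℝ} (hv : ContDiff ℝ 2 v) (x : R2) (t : ℝ) :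
    ∫ z, fderiv ℝ v (x + t • z) z * wt z = t * ∫ z, lap v (x + t • z) * wtPot z := by
  set a : R2 → R2 := fun z => x + t • z with ha
  have hac : ContDiff ℝ 1 a := by fun_prop
  have had (z : R2) : HasFDerivAt a (t • ContinuousLinearMap.id ℝ R2) z :=
    ((hasFDerivAt_id z).const_smul t).const_add x
  have hD (i : Fin 2) : ContDiff ℝ 1 fun y => fderiv ℝ v y (EuclideanSpace.single i 1) :=
    contDiff_fderiv_single hv i
  have hDa (i : Fin 2) (z : R2) :
      fderiv ℝ (fun z => fderiv ℝ v (a z) (EuclideanSpace.single i 1)) z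
        (EuclideanSpace.single i 1) =
      t * fderiv ℝ (fun y => fderiv ℝ v y (EuclideanSpace.single i 1)) (a z)
        (EuclideanSpace.single i 1) := by
    have := (((hD i).differentiable (by norm_num) (a z)).hasFDerivAt.comp z (had z)).fderiv
    change fderiv ℝ ((fun y => fderiv ℝ v y (EuclideanSpace.single i 1)) ∘ a) z _ = _
    rw [this]
    simp
  have hpot : ContDiff ℝ 1 wtPot := by
    rw [contDiff_one_iff_fderiv]
    refine ⟨fun z => (hasFDerivAt_wtPot z).differentiableAt, ?_⟩
    rw [show fderiv ℝ wtPot = fun z => -(wt z) • innerSL ℝ z from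
      funext fun z => (hasFDerivAt_wtPot z).fderiv]
    have := continuous_wt
    fun_prop
  have hpart (i : Fin 2) :
      ∫ z, fderiv ℝ v (a z) (EuclideanSpace.single i 1) * (wt z * z i) =
      ∫ z, t * fderiv ℝ (fun y => fderiv ℝ v y (EuclideanSpace.single i 1)) (a z)
        (EuclideanSpace.single i 1) * wtPot z := by
    have hcoord : Continuous fun z : R2 => z i := by fun_prop
    have h := integral_mul_fderiv_eq_neg_fderiv_mul_of_integrable (μ := (volume : Measure R2))
      (f := fun z => fderiv ℝ v (a z) (EuclideanSpace.single i 1)) (g := wtPot)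
      (v := EuclideanSpace.single i 1) ?_ ?_ ?_ ?_ ?_
    · simp only [fderiv_wtPot_single, mul_neg, integral_neg, neg_inj, hDa] at h
      exact h
    · simp only [hDa]
      exact integrable_mul_wtPot (continuous_const.mul
        ((((hD i).continuous_fderiv (by norm_num)).comp hac.continuous).clm_apply
          continuous_const))
    · simp only [fderiv_wtPot_single]
      have := integrable_mul_wt (((hD i).continuous.comp hac.continuous).mul hcoord).neg
      refine this.congr (Eventually.of_forall fun z => ?_)
      simp; ring
    · exact integrable_mul_wtPot ((hD i).continuous.comp hac.continuous)
    · exact fun z _ => ((hD i).comp hac).differentiable (by norm_num) z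
    · exact fun z _ => hpot.differentiable (by norm_num) z
  calc ∫ z, fderiv ℝ v (x + t • z) z * wt z
      = ∫ z, ∑ i : Fin 2, fderiv ℝ v (a z) (EuclideanSpace.single i 1) * (wt z * z i) := by
        refine integral_congr_ae (Eventually.of_forall fun z => ?_)
        change fderiv ℝ v (a z) z * wt z = _
        conv_lhs => rw [eq_sum_single z, map_sum, Finset.sum_mul, ← eq_sum_single z]
        refine Finset.sum_congr rfl fun i _ => ?_
        simp; ring
    _ = ∑ i : Fin 2, ∫ z, fderiv ℝ v (a z) (EuclideanSpace.single i 1) * (wt z * z i) := by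
        refine integral_finsetSum _ fun i _ => ?_
        have hcoord : Continuous fun z : R2 => z i := by fun_prop
        have := integrable_mul_wt (((hD i).continuous.comp hac.continuous).mul hcoord)
        refine this.congr (Eventually.of_forall fun z => ?_)
        simp; ring
    _ = ∑ i : Fin 2, ∫ z, t * fderiv ℝ (fun y => fderiv ℝ v y (EuclideanSpace.single i 1)) (a z)
        (EuclideanSpace.single i 1) * wtPot z := by simp only [hpart]
    _ = ∫ z, ∑ i : Fin 2, t * fderiv ℝ (fun y => fderiv ℝ v y (EuclideanSpace.single i 1)) (a z)
        (EuclideanSpace.single i 1) * wtPot z := by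
        refine (integral_finsetSum _ fun i _ => ?_).symm
        exact integrable_mul_wtPot (continuous_const.mul
          ((((hD i).continuous_fderiv (by norm_num)).comp hac.continuous).clm_apply
            continuous_const))
    _ = t * ∫ z, lap v (x + t • z) * wtPot z := by
        rw [← integral_const_mul]
        refine integral_congr_ae (Eventually.of_forall fun z => ?_)
        simp only [lap, Finset.sum_mul, Finset.mul_sum, ha]
        exact Finset.sum_congr rfl fun i _ => by ring

lemma hasDerivAt_integral_mul_wt {v : R2 → ℝ} (hv : ContDiff ℝ 2 v) (x : R2) (t : ℝ) :
    HasDerivAt (fun t : ℝ => ∫ z, v (x + t • z) * wt z)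
      (t * ∫ z, lap v (x + t • z) * wtPot z) t := by
  rw [← integral_fderiv_mul_wt hv]
  have hfc : Continuous (fderiv ℝ v) := hv.continuous_fderiv (by norm_num)
  obtain ⟨C, hC⟩ := (isCompact_closedBall x (|t| + 1)).exists_bound_of_continuousOn
    hfc.continuousOn
  refine (hasDerivAt_integral_of_dominated_loc_of_deriv_le (bound := fun z => C * wt z)
    (F' := fun s z => fderiv ℝ v (x + s • z) z * wt z)
    (ball_mem_nhds t one_pos) ?_ ?_ ?_ ?_ ?_ ?_).2
  · refine Eventually.of_forall fun s => Continuous.aestronglyMeasurable ?_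
    exact (hv.continuous.comp (by fun_prop)).mul continuous_wt
  · exact integrable_mul_wt (hv.continuous.comp (by fun_prop))
  · refine Continuous.aestronglyMeasurable ?_
    exact ((hfc.comp (by fun_prop)).clm_apply continuous_id).mul continuous_wt
  · refine Eventually.of_forall fun z s hs => ?_
    rw [norm_mul, Real.norm_of_nonneg (wt_nonneg z)]
    rcases le_or_gt 1 ‖z‖ with hz | hz
    · simp [wt_eq_zero hz]
    · refine mul_le_mul_of_nonneg_right ?_ (wt_nonneg z)
      have hst : |s| ≤ |t| + 1 := by
        rw [mem_ball, Real.dist_eq] at hs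
        have := abs_sub_abs_le_abs_sub s t
        linarith
      have hmem : x + s • z ∈ closedBall x (|t| + 1) := by
        rw [mem_closedBall, dist_eq_norm, add_sub_cancel_left, norm_smul, Real.norm_eq_abs]
        nlinarith [norm_nonneg z, abs_nonneg s]
      have h1 := (fderiv ℝ v (x + s • z)).le_opNorm z
      nlinarith [hC _ hmem, norm_nonneg (fderiv ℝ v (x + s • z)), norm_nonneg z]
  · exact integrable_wt.const_mul C
  · refine Eventually.of_forall fun z s _ => HasDerivAt.mul_const ?_ _
    have h1 : HasDerivAt (fun s : ℝ => x + s • z) z s := by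
      simpa using ((hasDerivAt_id s).smul_const z).const_add x
    exact (hv.differentiable (by norm_num) _).hasFDerivAt.comp_hasDerivAt s h1

/-- Mean value inequality for a function whose Laplacian is bounded below. -/
lemma mul_integral_wt_le {v : R2 → ℝ} (hv : ContDiff ℝ 2 v) {x : R2} {r c : ℝ} (hr : 0 ≤ r)
    (hc : 0 ≤ c) (hlap : ∀ y ∈ ball x r, -c ≤ lap v y) :
    v x * ∫ z, wt z ≤ (∫ z, v (x + r • z) * wt z) + c * r ^ 2 * ∫ z, wt z := by
  set I := ∫ z, wt z with hI
  have hI0 : 0 < I := integral_wt_pos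
  set A : ℝ → ℝ := fun t => (∫ z, v (x + t • z) * wt z) + c * I * t ^ 2 with hA
  have hd (t : ℝ) : HasDerivAt A
      (t * (∫ z, lap v (x + t • z) * wtPot z) + c * I * (2 * t)) t := by
    have := (hasDerivAt_integral_mul_wt hv x t).add
      (((hasDerivAt_pow 2 t)).const_mul (c * I))
    refine this.congr_deriv ?_
    simp
  have hmono : MonotoneOn A (Icc 0 r) := by
    refine monotoneOn_of_deriv_nonneg (convex_Icc 0 r)
      (fun t _ => (hd t).continuousAt.continuousWithinAt)
      (fun t _ => (hd t).differentiableAt.differentiableWithinAt) fun t ht => ?_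
    rw [interior_Icc] at ht
    rw [(hd t).deriv]
    have h1 : -(c * I) ≤ ∫ z, lap v (x + t • z) * wtPot z := by
      rw [hI, ← integral_const_mul, ← integral_neg]
      refine integral_mono (integrable_wt.const_mul c).neg
        (integrable_mul_wtPot ((continuous_lap hv).comp (by fun_prop))) fun z => ?_
      rcases le_or_gt 1 ‖z‖ with hz | hz
      · simp [wt_eq_zero hz, wtPot_eq_zero hz]
      · have hmem : x + t • z ∈ ball x r := by
          rw [mem_ball, dist_eq_norm, add_sub_cancel_left, norm_smul, Real.norm_of_nonneg ht.1.le]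
          nlinarith [ht.1, ht.2, norm_nonneg z]
        have := hlap _ hmem
        simp only
        nlinarith [wtPot_nonneg z, wtPot_le_wt z]
    nlinarith [ht.1, mul_nonneg hc hI0.le]
  have := hmono (left_mem_Icc.2 hr) (right_mem_Icc.2 hr) hr
  simp only [hA, zero_smul, add_zero, integral_const_mul] at this
  nlinarith

lemma integral_comp_mul_wt (v : R2 → ℝ) (x : R2) {r : ℝ} (hr : 0 < r) :
    ∫ y, v y * wt (r⁻¹ • (y - x)) = r ^ 2 * ∫ z, v (x + r • z) * wt z := by
  have h1 : ∫ y, v y * wt (r⁻¹ • (y - x)) = ∫ y, v (x + y) * wt (r⁻¹ • y) := by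
    rw [← integral_add_left_eq_self _ x]
    simp
  have h2 := Measure.integral_comp_smul (volume : Measure R2)
    (fun y => v (x + y) * wt (r⁻¹ • y)) r
  simp only [inv_smul_smul₀ hr.ne', finrank_euclideanSpace, Fintype.card_fin, smul_eq_mul] at h2
  rw [h1, h2, abs_of_pos (by positivity)]
  field_simp

lemma wt_rescale_le {x y z : R2} {r R : ℝ} (hr : 0 < r) (h : dist y x + r ≤ R / 2) :
    wt (r⁻¹ • (z - y)) ≤ 16 / 9 * wt (R⁻¹ • (z - x)) := by
  have hR : 0 < R := by linarith [dist_nonneg (x := y) (y := x)]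
  rcases le_or_gt 1 ‖r⁻¹ • (z - y)‖ with hz | hz
  · rw [wt_eq_zero hz]
    have := wt_nonneg (R⁻¹ • (z - x))
    positivity
  · rw [norm_smul, norm_inv, Real.norm_of_nonneg hr.le, inv_mul_lt_iff₀ hr, mul_one,
      ← dist_eq_norm] at hz
    have h1 : ‖R⁻¹ • (z - x)‖ ≤ 1 / 2 := by
      rw [norm_smul, norm_inv, Real.norm_of_nonneg hR.le, inv_mul_le_iff₀ hR, ← dist_eq_norm]
      linarith [dist_triangle z y x]
    linarith [le_wt h1, wt_le_one (r⁻¹ • (z - y))]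

lemma integrable_mul_wt_rescale {v : R2 → ℝ} (hv : Continuous v) (x : R2) {r : ℝ} (hr : 0 < r) :
    Integrable fun z => v z * wt (r⁻¹ • (z - x)) := by
  refine (hv.mul (continuous_wt.comp (by fun_prop))).integrable_of_hasCompactSupport ?_
  refine HasCompactSupport.intro (isCompact_closedBall x r) fun z hz => ?_
  rw [mem_closedBall, not_le, dist_eq_norm] at hz
  refine mul_eq_zero_of_right _ (wt_eq_zero ?_)
  rw [norm_smul, norm_inv, Real.norm_of_nonneg hr.le, le_inv_mul_iff₀ hr]
  linarith

lemma integral_mul_wt_le_of_dist {v : R2 → ℝ} (hv : Continuous v) {x y : R2} {r R : ℝ}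
    (hr : 0 < r) (h : dist y x + r ≤ R / 2) (hv0 : ∀ z ∈ ball x R, 0 ≤ v z) :
    r ^ 2 * ∫ z, v (y + r • z) * wt z ≤ 16 / 9 * (R ^ 2 * ∫ z, v (x + R • z) * wt z) := by
  have hR : 0 < R := by linarith [dist_nonneg (x := y) (y := x)]
  rw [← integral_comp_mul_wt v y hr, ← integral_comp_mul_wt v x hR, ← integral_const_mul]
  refine integral_mono (integrable_mul_wt_rescale hv y hr)
    ((integrable_mul_wt_rescale hv x hR).const_mul _) fun z => ?_
  have h1 := wt_rescale_le (z := z) hr h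
  rcases le_or_gt R (dist z x) with hz | hz
  · have h2 : wt (R⁻¹ • (z - x)) = 0 := wt_eq_zero (by
      rw [norm_smul, norm_inv, Real.norm_of_nonneg hR.le, le_inv_mul_iff₀ hR, ← dist_eq_norm]
      linarith)
    have h3 : wt (r⁻¹ • (z - y)) = 0 := le_antisymm (by linarith) (wt_nonneg _)
    simp [h2, h3]
  · have := hv0 z hz
    simp only
    nlinarith

lemma lap_congr {v w : R2 → ℝ} {x : R2} (h : v =ᶠ[𝓝 x] w) : lap v x = lap w x := by
  unfold lap
  refine Finset.sum_congr rfl fun i _ => ?_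
  rw [Filter.EventuallyEq.fderiv_eq]
  filter_upwards [h.eventuallyEq_nhds] with y hy
  rw [hy.fderiv_eq]

lemma lap_neg (v : R2 → ℝ) (x : R2) : lap (fun y => -v y) x = -lap v x := by
  simp [lap, fderiv_fun_neg]

lemma lap_const_sub (v : R2 → ℝ) (c : ℝ) (x : R2) : lap (fun y => c - v y) x = -lap v x := by
  simp [lap, fderiv_const_sub, fderiv_fun_neg]

/-- A quantitative Harnack inequality for nonnegative functions vanishing at the center. -/
lemma le_of_abs_lap_le {v : R2 → ℝ} (hv : ContDiff ℝ 2 v) {x y : R2} {r c : ℝ} (hr : 0 < r)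
    (hc : 0 ≤ c) (hv0 : ∀ z ∈ ball x (4 * r), 0 ≤ v z) (hx : v x = 0)
    (hlap : ∀ z ∈ ball x (4 * r), |lap v z| ≤ c) (hy : dist y x ≤ r) :
    v y ≤ 500 * c * r ^ 2 := by
  have hI := integral_wt_pos
  have h1 := mul_integral_wt_le hv.neg (x := x) (r := 4 * r) (by positivity) hc fun z hz => by
    rw [lap_neg]
    exact neg_le_neg (le_trans (le_abs_self _) (hlap z hz))
  have h2 := mul_integral_wt_le hv (x := y) hr.le hc fun z hz =>
    (abs_le.1 (hlap z (by
      rw [mem_ball] at hz ⊢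
      linarith [dist_triangle z y x]))).1
  have h3 := integral_mul_wt_le_of_dist hv.continuous hr
    (show dist y x + r ≤ (4 * r) / 2 by linarith) hv0
  simp only [hx, neg_zero, zero_mul, neg_mul, integral_neg] at h1
  have h4 : ∫ z, v (y + r • z) * wt z ≤ 16 / 9 * 16 * ∫ z, v (x + (4 * r) • z) * wt z := by
    refine le_of_mul_le_mul_left ?_ (show 0 < r ^ 2 by positivity)
    calc _ ≤ _ := h3
      _ = _ := by ring
  refine le_of_mul_le_mul_right ?_ hI
  have h5 : 0 ≤ c * r ^ 2 * ∫ z, wt z := by positivity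
  nlinarith

/-- Interior bound: on a ball well inside `Ω`, the function stays close to its maximum. -/
lemma sub_le_of_ball_subset {Ω : Set R2} (hop : IsOpen Ω) {u : R2 → ℝ} (hu : ContDiffOn ℝ 2 u Ω)
    {x y : R2} {r c : ℝ} (hr : 0 < r) (hc : 0 ≤ c) (hmax : ∀ z ∈ Ω, u z ≤ u x)
    (hlap : ∀ z ∈ Ω, |lap u z| ≤ c) (hball : closedBall x (5 * r) ⊆ Ω) (hy : dist y x ≤ r) :
    u x - u y ≤ 500 * c * r ^ 2 := by
  let f : ContDiffBump x := ⟨4 * r, 5 * r, by positivity, by linarith⟩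
  set v : R2 → ℝ := fun z => f z * (u x - u z) with hv
  have hf1 : ∀ z ∈ closedBall x (4 * r), f z = 1 := fun z hz => f.one_of_mem_closedBall hz
  have hvC : ContDiff ℝ 2 v := by
    rw [contDiff_iff_contDiffAt]
    intro z
    by_cases hz : z ∈ Ω
    · exact f.contDiffAt.mul (contDiffAt_const.sub (hu.contDiffAt (hop.mem_nhds hz)))
    · have hz' : z ∉ tsupport f := fun h => hz (hball (by rwa [f.tsupport_eq] at h))
      refine (contDiffAt_const (c := (0 : ℝ))).congr_of_eventuallyEq ?_
      filter_upwards [(isClosed_tsupport f).isOpen_compl.mem_nhds hz'] with w hw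
      rw [hv]
      simp [image_eq_zero_of_notMem_tsupport hw]
  have hsub : ball x (4 * r) ⊆ Ω := fun z hz => hball (closedBall_subset_closedBall
    (by linarith) (ball_subset_closedBall hz))
  have hvy : v y = u x - u y := by
    rw [hv]
    simp only
    rw [hf1 y (by rw [mem_closedBall]; linarith), one_mul]
  rw [← hvy]
  refine le_of_abs_lap_le hvC hr hc (fun z hz => ?_) (by simp [hv]) (fun z hz => ?_) hy
  · exact mul_nonneg f.nonneg (sub_nonneg.2 (hmax z (hsub hz)))
  · have : v =ᶠ[𝓝 z] fun w => u x - u w := by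
      filter_upwards [isOpen_ball.mem_nhds hz] with w hw
      simp [hv, hf1 w (ball_subset_closedBall hw)]
    rw [lap_congr this, lap_const_sub, abs_neg]
    exact hlap z (hsub hz)

lemma lap_comp {u : R2 → ℝ} {b b' b'' : ℝ → ℝ} (hb : ∀ s, HasDerivAt b (b' s) s)
    (hb' : ∀ s, HasDerivAt b' (b'' s) s) {x : R2} (hu : ContDiffAt ℝ 2 u x) :
    lap (fun y => b (u y)) x =
      b'' (u x) * ∑ i : Fin 2, fderiv ℝ u x (EuclideanSpace.single i 1) ^ 2 +
        b' (u x) * lap u x := by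
  have hev : ∀ᶠ y in 𝓝 x, DifferentiableAt ℝ u y :=
    (hu.eventually (by simp)).mono fun y hy => hy.differentiableAt (by norm_num)
  have hux : DifferentiableAt ℝ u x := hev.self_of_nhds
  have hf (i : Fin 2) : DifferentiableAt ℝ
      (fun y => fderiv ℝ u y (EuclideanSpace.single i 1)) x :=
    ((hu.fderiv_right (m := 1) (by norm_num)).clm_apply contDiffAt_const).differentiableAt
      (by norm_num)
  unfold lap
  rw [Finset.mul_sum, Finset.mul_sum, ← Finset.sum_add_distrib]
  refine Finset.sum_congr rfl fun i _ => ?_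
  have h1 : (fun y => fderiv ℝ (fun y => b (u y)) y (EuclideanSpace.single i 1)) =ᶠ[𝓝 x]
      fun y => b' (u y) * fderiv ℝ u y (EuclideanSpace.single i 1) := by
    filter_upwards [hev] with y hy
    have := ((hb (u y)).comp_hasFDerivAt y hy.hasFDerivAt).fderiv
    rw [show (fun y => b (u y)) = b ∘ u from rfl, this]
    simp
  rw [h1.fderiv_eq]
  have h2 : HasFDerivAt (fun y => b' (u y)) (b'' (u x) • fderiv ℝ u x) x :=
    (hb' (u x)).comp_hasFDerivAt x hux.hasFDerivAt
  rw [(h2.fun_mul (hf i).hasFDerivAt).fderiv]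
  simp
  ring

/-- A `C²` truncation of the positive part of `u`, extended by zero. -/
lemma exists_truncation {Ω : Set R2} (hop : IsOpen Ω) {u : R2 → ℝ} (hu : ContDiffOn ℝ 2 u Ω)
    (huc : ContinuousOn u (closure Ω)) (hu0 : ∀ x ∈ frontier Ω, u x = 0) {M c δ : ℝ}
    (hM : 0 < M) (hmax : ∀ x ∈ Ω, u x ≤ M) (hc : 0 ≤ c) (hlap : ∀ x ∈ Ω, -c ≤ lap u x)
    (hδ : 0 < δ) :
    ∃ v : R2 → ℝ, ContDiff ℝ 2 v ∧ (∀ x ∈ Ω, v x = max (u x - δ) 0 ^ 3 / M ^ 3) ∧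
      (∀ x ∉ Ω, v x = 0) ∧ (∀ x, -(3 * c / M) ≤ lap v x) ∧
      (∀ x ∈ Ω, ‖fderiv ℝ v x‖ ≤ 3 / M * ‖fderiv ℝ u x‖) ∧ (∀ x ∉ Ω, fderiv ℝ v x = 0) := by
  set b : ℝ → ℝ := fun s => max (s - δ) 0 ^ 3 / M ^ 3 with hb
  set b' : ℝ → ℝ := fun s => 3 * max (s - δ) 0 ^ 2 / M ^ 3 with hb'
  set b'' : ℝ → ℝ := fun s => 6 * max (s - δ) 0 / M ^ 3 with hb''
  have hbd (s : ℝ) : HasDerivAt b (b' s) s := by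
    have := (((hasDerivAt_max_zero_pow 1 (s - δ))).comp s
      ((hasDerivAt_id s).sub_const δ)).div_const (M ^ 3)
    refine (this.congr_deriv ?_)
    simp [hb']
    ring
  have hbd' (s : ℝ) : HasDerivAt b' (b'' s) s := by
    have := ((((hasDerivAt_max_zero_pow 0 (s - δ))).comp s
      ((hasDerivAt_id s).sub_const δ)).const_mul 3).div_const (M ^ 3)
    refine (this.congr_deriv ?_)
    simp [hb'']
    ring
  have hbC : ContDiff ℝ 2 b :=
    ((contDiff_max_zero_pow 2).comp (contDiff_id.sub contDiff_const)).div_const _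
  have hb'0 (s : ℝ) : 0 ≤ b' s := by simp only [hb']; positivity
  have hb'1 (s : ℝ) (hs : s ≤ M) : b' s ≤ 3 / M := by
    have h1 : max (s - δ) 0 ≤ M := max_le (by linarith) hM.le
    have h2 : max (s - δ) 0 ^ 2 ≤ M ^ 2 := pow_le_pow_left₀ (le_max_right _ _) h1 2
    simp only [hb']
    rw [div_le_div_iff₀ (by positivity) hM]
    nlinarith
  have hb''0 (s : ℝ) : 0 ≤ b'' s := by
    have : 0 ≤ max (s - δ) 0 := le_max_right _ _
    simp only [hb'']
    positivity
  have hvΩ : ∀ x ∈ Ω, Ω.indicator (fun x => b (u x)) =ᶠ[𝓝 x] fun x => b (u x) := fun x hx => by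
    filter_upwards [hop.mem_nhds hx] with y hy
    simp [hy]
  have hvout : ∀ x ∉ Ω, Ω.indicator (fun x => b (u x)) =ᶠ[𝓝 x] fun _ => 0 := fun x hx => by
    by_cases hxc : x ∈ closure Ω
    · have hxf : x ∈ frontier Ω := ⟨hxc, fun h => hx (interior_subset h)⟩
      have h1 := (huc x hxc).eventually (gt_mem_nhds (show u x < δ by rw [hu0 x hxf]; exact hδ))
      filter_upwards [eventually_nhdsWithin_iff.1 h1] with y hy
      by_cases hyΩ : y ∈ Ω
      · have := hy (subset_closure hyΩ)
        simp [hyΩ, hb, max_eq_right (show u y - δ ≤ 0 by linarith)]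
      · simp [hyΩ]
    · filter_upwards [isClosed_closure.isOpen_compl.mem_nhds hxc] with y hy
      simp [show y ∉ Ω from fun h => hy (subset_closure h)]
  refine ⟨Ω.indicator (fun x => b (u x)), ?_, fun x hx => by simp [hx, hb],
    fun x hx => by simp [hx], fun x => ?_, fun x hx => ?_, fun x hx => ?_⟩
  · rw [contDiff_iff_contDiffAt]
    intro x
    by_cases hx : x ∈ Ω
    · exact (hbC.contDiffAt.comp x (hu.contDiffAt (hop.mem_nhds hx))).congr_of_eventuallyEq
        (hvΩ x hx)
    · exact contDiffAt_const.congr_of_eventuallyEq (hvout x hx)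
  · by_cases hx : x ∈ Ω
    · rw [lap_congr (hvΩ x hx), lap_comp hbd hbd' (hu.contDiffAt (hop.mem_nhds hx))]
      have h1 : 0 ≤ b'' (u x) * ∑ i : Fin 2, fderiv ℝ u x (EuclideanSpace.single i 1) ^ 2 :=
        mul_nonneg (hb''0 _) (Finset.sum_nonneg fun i _ => sq_nonneg _)
      have h2 := hb'1 _ (hmax x hx)
      have h3 : b' (u x) * (-c) ≤ b' (u x) * lap u x :=
        mul_le_mul_of_nonneg_left (hlap x hx) (hb'0 _)
      have h4 : b' (u x) * c ≤ 3 / M * c := mul_le_mul_of_nonneg_right h2 hc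
      have h5 : 3 * c / M = 3 / M * c := by ring
      linarith
    · rw [lap_congr (hvout x hx)]
      simp [lap]
      positivity
  · have hux := (hu.contDiffAt (hop.mem_nhds hx)).differentiableAt (by norm_num)
    have hbu : HasFDerivAt (fun x => b (u x)) (b' (u x) • fderiv ℝ u x) x :=
      (hbd (u x)).comp_hasFDerivAt x hux.hasFDerivAt
    rw [(hvΩ x hx).fderiv_eq, hbu.fderiv, norm_smul, Real.norm_of_nonneg (hb'0 _)]
    exact mul_le_mul_of_nonneg_right (hb'1 _ (hmax x hx)) (norm_nonneg _)
  · rw [(hvout x hx).fderiv_eq]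
    simp

lemma norm_le_abs_add_abs (z : R2) : ‖z‖ ≤ |z 0| + |z 1| := by
  rw [EuclideanSpace.norm_eq, Fin.sum_univ_two]
  refine Real.sqrt_le_iff.2 ⟨by positivity, ?_⟩
  simp only [Real.norm_eq_abs]
  nlinarith [abs_nonneg (z 0), abs_nonneg (z 1)]

/-- Uniform local description of a compact smooth boundary by Lipschitz graphs. -/
lemma exists_uniform_graph {Ω : Set R2} (hbdd : Bornology.IsBounded Ω) (hsm : SmoothBoundary Ω) :
    ∃ r > (0 : ℝ), ∃ K > (0 : ℝ), ∀ q ∈ frontier Ω, ∃ e : R2 ≃ᵢ R2, ∀ t : ℝ, |t - e q 0| ≤ r →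
      ∃ y : ℝ, |y - e q 1| ≤ K * |t - e q 0| ∧ e.symm !₂[t, y] ∈ frontier Ω := by
  have hcomp : IsCompact (frontier Ω) :=
    hbdd.isCompact_closure.of_isClosed_subset isClosed_frontier frontier_subset_closure
  refine hcomp.induction_on (p := fun S => ∃ r > (0 : ℝ), ∃ K > (0 : ℝ), ∀ q ∈ S,
    ∃ e : R2 ≃ᵢ R2, ∀ t : ℝ, |t - e q 0| ≤ r →
      ∃ y : ℝ, |y - e q 1| ≤ K * |t - e q 0| ∧ e.symm !₂[t, y] ∈ frontier Ω) ?_ ?_ ?_ ?_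
  · exact ⟨1, one_pos, 1, one_pos, fun q hq => hq.elim⟩
  · rintro S T hST ⟨r, hr, K, hK, h⟩
    exact ⟨r, hr, K, hK, fun q hq => h q (hST hq)⟩
  · rintro S T ⟨r, hr, K, hK, h⟩ ⟨r', hr', K', hK', h'⟩
    refine ⟨min r r', lt_min hr hr', max K K', lt_max_of_lt_left hK, ?_⟩
    rintro q (hq | hq)
    · obtain ⟨e, he⟩ := h q hq
      refine ⟨e, fun t ht => ?_⟩
      obtain ⟨y, hy, hy'⟩ := he t (ht.trans (min_le_left _ _))
      exact ⟨y, hy.trans (mul_le_mul_of_nonneg_right (le_max_left _ _) (abs_nonneg _)), hy'⟩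
    · obtain ⟨e, he⟩ := h' q hq
      refine ⟨e, fun t ht => ?_⟩
      obtain ⟨y, hy, hy'⟩ := he t (ht.trans (min_le_right _ _))
      exact ⟨y, hy.trans (mul_le_mul_of_nonneg_right (le_max_right _ _) (abs_nonneg _)), hy'⟩
  · intro x hx
    obtain ⟨V, hV, hxV, e, g, hg, hgraph⟩ := hsm x hx
    have hg1 : ContDiffAt ℝ 1 g (e x 0) := (hg.of_le (by exact_mod_cast le_top)).contDiffAt
    obtain ⟨K, U, hU, hK⟩ := hg1.exists_lipschitzOnWith
    obtain ⟨ρ, hρ, hρU⟩ := Metric.mem_nhds_iff.1 hU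
    obtain ⟨σ, hσ, hσV⟩ := Metric.mem_nhds_iff.1 (hV.mem_nhds hxV)
    set r := min (ρ / 2) (σ / (2 * (2 + K))) with hr
    have hr0 : 0 < r := lt_min (by positivity) (by positivity)
    have hrσ : (2 + K) * r ≤ σ / 2 := by
      calc (2 + K) * r ≤ (2 + K) * (σ / (2 * (2 + K))) := by
            gcongr
            exact min_le_right _ _
        _ = σ / 2 := by field_simp
    have hK0 : (0 : ℝ) ≤ K := K.2
    refine ⟨frontier Ω ∩ ball x r, inter_mem_nhdsWithin _ (ball_mem_nhds x hr0), r, hr0, K + 1,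
      by positivity, ?_⟩
    rintro q ⟨hq, hqx⟩
    rw [mem_ball] at hqx
    refine ⟨e, fun t ht => ⟨g t, ?_⟩⟩
    have hqV : q ∈ V := hσV (by rw [mem_ball]; nlinarith)
    have hq1 : e q 1 = g (e q 0) := by
      have : q ∈ frontier Ω ∩ V := ⟨hq, hqV⟩
      rw [hgraph] at this
      exact this.2
    have hqx0 : |e q 0 - e x 0| < r := by
      have h1 := PiLp.norm_apply_le (e q - e x) 0
      rw [← dist_eq_norm, e.dist_eq, Real.norm_eq_abs] at h1
      simpa using h1.trans_lt hqx
    have hrρ : r ≤ ρ / 2 := min_le_left _ _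
    have hgl : |g t - e q 1| ≤ K * |t - e q 0| := by
      rw [hq1]
      have := hK.dist_le_mul t (hρU ?_) (e q 0) (hρU ?_)
      · simpa [Real.dist_eq] using this
      · rw [mem_ball, Real.dist_eq]
        have := abs_sub_le t (e q 0) (e x 0)
        linarith
      · rw [mem_ball, Real.dist_eq]
        linarith
    refine ⟨hgl.trans (mul_le_mul_of_nonneg_right (by linarith) (abs_nonneg _)), ?_⟩
    have hzV : e.symm !₂[t, g t] ∈ V := by
      refine hσV ?_
      have h1 : dist (e.symm !₂[t, g t]) q ≤ (1 + K) * r := by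
        rw [← e.dist_eq, e.apply_symm_apply, dist_eq_norm]
        refine (norm_le_abs_add_abs _).trans ?_
        have : |t - e q 0| + |g t - e q 1| ≤ (1 + K) * r := by nlinarith
        simpa using this
      rw [mem_ball]
      have := dist_triangle (e.symm !₂[t, g t]) q x
      nlinarith
    have : e.symm !₂[t, g t] ∈ frontier Ω ∩ V := by
      rw [hgraph]
      refine ⟨hzV, ?_⟩
      simp
    exact this.1

/-- The image under `e.symm` of the rectangle of half-sides `s`, `l` centered at `(a, b)`. -/
def box (e : R2 ≃ᵢ R2) (a b s l : ℝ) : Set R2 :=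
  {x | e x 0 ∈ Icc (a - s) (a + s) ∧ e x 1 ∈ Icc (b - l) (b + l)}

/-- Cartesian coordinates attached to an isometry of the plane. -/
def chart (e : R2 ≃ᵢ R2) : ℝ × ℝ ≃ᵐ R2 :=
  (MeasurableEquiv.finTwoArrow (α := ℝ)).symm.trans
    ((MeasurableEquiv.toLp 2 (Fin 2 → ℝ)).trans e.symm.toHomeomorph.toMeasurableEquiv)

lemma chart_apply (e : R2 ≃ᵢ R2) (t y : ℝ) : chart e (t, y) = e.symm !₂[t, y] := rfl

lemma exists_linear_symm (e : R2 ≃ᵢ R2) :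
    ∃ (A : R2 ≃ₗᵢ[ℝ] R2) (q : R2), ∀ x, e.symm x = A x + q := by
  refine ⟨e.symm.toRealAffineIsometryEquiv.linearIsometryEquiv, e.symm 0, fun x => ?_⟩
  have := e.symm.toRealAffineIsometryEquiv.map_vadd 0 x
  simpa using this

lemma measurePreserving_chart (e : R2 ≃ᵢ R2) : MeasurePreserving (chart e) := by
  obtain ⟨A, q, h⟩ := exists_linear_symm e
  have h1 : MeasurePreserving (e.symm : R2 → R2) := by
    rw [show (e.symm : R2 → R2) = (fun x => x + q) ∘ A from funext h]
    exact (measurePreserving_add_right volume q).comp A.measurePreserving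
  exact h1.comp ((PiLp.volume_preserving_toLp (Fin 2)).comp
    ((volume_preserving_finTwoArrow ℝ).symm _))

lemma preimage_box (e : R2 ≃ᵢ R2) (a b s l : ℝ) :
    chart e ⁻¹' box e a b s l = Icc (a - s) (a + s) ×ˢ Icc (b - l) (b + l) := by
  ext ⟨t, y⟩
  simp [box, chart_apply, -mem_Icc, -Icc_prod_Icc]

lemma continuous_chart (e : R2 ≃ᵢ R2) : Continuous (chart e) := by
  have : (chart e : ℝ × ℝ → R2) = fun z => e.symm !₂[z.1, z.2] := rfl
  rw [this]
  refine e.symm.continuous.comp ?_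
  fun_prop

lemma setIntegral_box (e : R2 ≃ᵢ R2) (a b s l : ℝ) {f : R2 → ℝ} (hf : Continuous f) :
    ∫ x in box e a b s l, f x = ∫ t in Icc (a - s) (a + s), ∫ y in Icc (b - l) (b + l),
      f (e.symm !₂[t, y]) := by
  rw [← (measurePreserving_chart e).setIntegral_preimage_emb (chart e).measurableEmbedding,
    preimage_box, Measure.volume_eq_prod, setIntegral_prod]
  · rfl
  · rw [← Measure.volume_eq_prod]
    exact (hf.comp (continuous_chart e)).continuousOn.integrableOn_compact
      (isCompact_Icc.prod isCompact_Icc)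

lemma isCompact_box (e : R2 ≃ᵢ R2) (a b s l : ℝ) : IsCompact (box e a b s l) := by
  have h := (isCompact_Icc.prod isCompact_Icc).image (continuous_chart e)
    (s := Icc (a - s) (a + s) ×ˢ Icc (b - l) (b + l))
  rwa [← preimage_box, image_preimage_eq _ (chart e).surjective] at h

lemma setIntegral_box_const (e : R2 ≃ᵢ R2) (a b c : ℝ) {s l : ℝ} (hs : 0 ≤ s) (hl : 0 ≤ l) :
    ∫ _ in box e a b s l, c = 4 * s * l * c := by
  rw [setIntegral_box e a b s l continuous_const]
  simp only [setIntegral_const, smul_eq_mul, Real.volume_real_Icc]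
  rw [max_eq_left (by linarith), max_eq_left (by linarith)]
  ring

/-- A one-dimensional Poincaré inequality for functions vanishing somewhere. -/
lemma setIntegral_Icc_le {F F' : ℝ → ℝ} (hF : ∀ y, HasDerivAt F (F' y) y) (hF' : Continuous F')
    {b l y₀ : ℝ} (hl : 0 < l) (hy₀ : y₀ ∈ Icc (b - l) (b + l)) (h0 : F y₀ = 0) :
    ∫ y in Icc (b - l) (b + l), F y ≤
      ∫ y in Icc (b - l) (b + l), (1 / 4 + 4 * l ^ 2 * F' y ^ 2) := by
  set J := Icc (b - l) (b + l) with hJ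
  have hFc : Continuous F := continuous_iff_continuousAt.2 fun y => (hF y).continuousAt
  have hint {f : ℝ → ℝ} (hf : Continuous f) : IntegrableOn f J :=
    hf.continuousOn.integrableOn_compact isCompact_Icc
  have hvol : volume.real J = 2 * l := by
    rw [hJ, Real.volume_real_Icc, max_eq_left (by linarith)]
    ring
  have h1 : ∀ y ∈ J, F y ≤ ∫ z in J, |F' z| := fun y hy => by
    have h2 : F y = ∫ z in y₀..y, F' z := by
      rw [intervalIntegral.integral_eq_sub_of_hasDerivAt (fun z _ => hF z)
        (hF'.intervalIntegrable _ _), h0, sub_zero]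
    rw [h2]
    have h3 : |∫ z in y₀..y, F' z| ≤ ∫ z in uIoc y₀ y, |F' z| := by
      simpa only [Real.norm_eq_abs] using
        intervalIntegral.norm_integral_le_integral_norm_uIoc (f := F') (a := y₀) (b := y)
          (μ := volume)
    refine (le_abs_self _).trans (h3.trans ?_)
    refine setIntegral_mono_set (hint hF'.abs) (Eventually.of_forall fun _ => abs_nonneg _)
      (LE.le.eventuallyLE ?_)
    exact uIoc_subset_uIcc.trans (by
      rw [hJ]
      exact uIcc_subset_Icc hy₀ hy)
  calc ∫ y in J, F y ≤ ∫ _ in J, (∫ z in J, |F' z|) :=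
        setIntegral_mono_on (hint hFc) (hint continuous_const) measurableSet_Icc h1
    _ = ∫ z in J, 2 * l * |F' z| := by
        rw [setIntegral_const, integral_const_mul, hvol, smul_eq_mul]
    _ ≤ _ := by
        refine setIntegral_mono (hint (continuous_const.mul hF'.abs))
          (hint (by fun_prop)) fun z => ?_
        simp only
        rw [← sq_abs (F' z)]
        nlinarith [sq_nonneg (1 / 2 - 2 * l * |F' z|)]

lemma setIntegral_box_le (e : R2 ≃ᵢ R2) {a b s l : ℝ} (hs : 0 < s) (hl : 0 < l) {v : R2 → ℝ}
    (hv : ContDiff ℝ 1 v)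
    (h0 : ∀ t ∈ Icc (a - s) (a + s), ∃ y ∈ Icc (b - l) (b + l), v (e.symm !₂[t, y]) = 0) :
    ∫ x in box e a b s l, v x ≤ s * l + 4 * l ^ 2 * ∫ x in box e a b s l, ‖fderiv ℝ v x‖ ^ 2 := by
  obtain ⟨A, q, hA⟩ := exists_linear_symm e
  have hfc : Continuous (fderiv ℝ v) := hv.continuous_fderiv (by norm_num)
  have hn : ‖A !₂[0, 1]‖ = 1 := by
    rw [A.norm_map, EuclideanSpace.norm_eq]
    simp
  have hder (t y : ℝ) : HasDerivAt (fun y => v (e.symm !₂[t, y]))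
      (fderiv ℝ v (e.symm !₂[t, y]) (A !₂[0, 1])) y := by
    have h1 : (fun y : ℝ => e.symm !₂[t, y]) = fun y : ℝ => (A !₂[t, 0] + q) + y • A !₂[0, 1] := by
      funext y
      rw [hA, ← map_smul, add_right_comm, ← map_add]
      congr 2
      ext i
      fin_cases i <;> simp
    have h2 : HasDerivAt (fun y : ℝ => e.symm !₂[t, y]) (A !₂[0, 1]) y := by
      rw [h1]
      simpa using ((hasDerivAt_id y).smul_const (A !₂[0, 1])).const_add (A !₂[t, 0] + q)
    exact (hv.differentiable (by norm_num) _).hasFDerivAt.comp_hasDerivAt y h2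
  have hch : Continuous fun z : ℝ × ℝ => e.symm !₂[z.1, z.2] := continuous_chart e
  have hline (t : ℝ) : Continuous fun y : ℝ => e.symm !₂[t, y] := hch.comp (Continuous.prodMk_right t)
  have hc2 : Continuous fun x => 1 / 4 + 4 * l ^ 2 * (fderiv ℝ v x (A !₂[0, 1])) ^ 2 :=
    continuous_const.add (continuous_const.mul ((hfc.clm_apply continuous_const).pow 2))
  have hc3 : Continuous fun x => 1 / 4 + 4 * l ^ 2 * ‖fderiv ℝ v x‖ ^ 2 :=
    continuous_const.add (continuous_const.mul (hfc.norm.pow 2))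
  have houter {f : R2 → ℝ} (hf : Continuous f) : IntegrableOn
      (fun t => ∫ y in Icc (b - l) (b + l), f (e.symm !₂[t, y])) (Icc (a - s) (a + s)) := by
    have : Integrable (fun z : ℝ × ℝ => f (e.symm !₂[z.1, z.2]))
        ((volume.restrict (Icc (a - s) (a + s))).prod (volume.restrict (Icc (b - l) (b + l)))) := by
      rw [Measure.prod_restrict, ← Measure.volume_eq_prod]
      exact (hf.comp hch).continuousOn.integrableOn_compact (isCompact_Icc.prod isCompact_Icc)
    exact this.integral_prod_left
  calc ∫ x in box e a b s l, v x
      = ∫ t in Icc (a - s) (a + s), ∫ y in Icc (b - l) (b + l), v (e.symm !₂[t, y]) :=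
        setIntegral_box e a b s l hv.continuous
    _ ≤ ∫ t in Icc (a - s) (a + s), ∫ y in Icc (b - l) (b + l),
        (1 / 4 + 4 * l ^ 2 * (fderiv ℝ v (e.symm !₂[t, y]) (A !₂[0, 1])) ^ 2) := by
        refine setIntegral_mono_on (houter hv.continuous) (houter hc2) measurableSet_Icc
          fun t ht => ?_
        obtain ⟨y, hy, hy0⟩ := h0 t ht
        exact setIntegral_Icc_le (hder t)
          ((hfc.comp (hline t)).clm_apply continuous_const) hl hy hy0
    _ = ∫ x in box e a b s l, (1 / 4 + 4 * l ^ 2 * (fderiv ℝ v x (A !₂[0, 1])) ^ 2) :=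
        (setIntegral_box e a b s l hc2).symm
    _ ≤ ∫ x in box e a b s l, (1 / 4 + 4 * l ^ 2 * ‖fderiv ℝ v x‖ ^ 2) := by
        refine setIntegral_mono (hc2.continuousOn.integrableOn_compact (isCompact_box e a b s l))
          (hc3.continuousOn.integrableOn_compact (isCompact_box e a b s l))
          fun x => ?_
        simp only
        have h1 := (fderiv ℝ v x).le_opNorm (A !₂[0, 1])
        rw [hn, mul_one, Real.norm_eq_abs] at h1
        have h2 := pow_le_pow_left₀ (abs_nonneg _) h1 2
        rw [sq_abs] at h2
        gcongr
    _ = s * l + 4 * l ^ 2 * ∫ x in box e a b s l, ‖fderiv ℝ v x‖ ^ 2 := by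
        rw [integral_add, setIntegral_box_const e a b _ hs.le hl.le, integral_const_mul]
        · ring
        · exact continuous_const.continuousOn.integrableOn_compact (isCompact_box e a b s l)
        · exact (continuous_const.mul (hfc.norm.pow 2)).continuousOn.integrableOn_compact
            (isCompact_box e a b s l)

lemma IsPreconnected.inter_frontier_nonempty_of_isOpen {X : Type*} [TopologicalSpace X]
    {s t : Set X} (hs : IsPreconnected s) (ht : IsOpen t) (h1 : (s ∩ t).Nonempty)
    (h2 : (s \ t).Nonempty) : (s ∩ frontier t).Nonempty := by
  by_contra hnot
  have hsub : ∀ y ∈ s, y ∉ t → y ∈ (closure t)ᶜ := fun y hy hyt hyc =>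
    hnot ⟨y, hy, by rw [ht.frontier_eq]; exact ⟨hyc, hyt⟩⟩
  obtain ⟨w, hw, hwt⟩ := h2
  obtain ⟨z, -, hz1, hz2⟩ := hs t (closure t)ᶜ ht isClosed_closure.isOpen_compl
    (fun y hy => (em (y ∈ t)).imp id (hsub y hy)) h1 ⟨w, hw, hsub w hw hwt⟩
  exact hz2 (subset_closure hz1)

/-- The truncated profile of a solution around its maximum point `x`. -/
lemma exists_profile {Ω : Set R2} (hop : IsOpen Ω) {u : R2 → ℝ} (hu : ContDiffOn ℝ 2 u Ω)
    (huc : ContinuousOn u (closure Ω)) (hu0 : ∀ y ∈ frontier Ω, u y = 0) {x : R2} (hx : x ∈ Ω)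
    {p ε : ℝ} (hp : 1 < p) (hε : 0 < ε) (hM : 0 < u x) (hmax : ∀ y ∈ Ω, u y ≤ u x)
    (hlap : ∀ y ∈ Ω, |lap u y| ≤ u x / (p * ε ^ 2)) :
    ∃ v : R2 → ℝ, ContDiff ℝ 2 v ∧ (∀ y, v y ≤ 1) ∧ (∀ y ∉ Ω, v y = 0) ∧
      (∀ ρ : ℝ, 0 ≤ ρ → p * ∫ z, (1 - v (x + ρ • z)) * wt z ≤
        3 * (1 + ρ ^ 2 / ε ^ 2) * ∫ z, wt z) ∧
      (∀ y ∈ Ω, ‖fderiv ℝ v y‖ ≤ 3 / u x * ‖fderiv ℝ u y‖) ∧ (∀ y ∉ Ω, fderiv ℝ v y = 0) := by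
  have hp0 : 0 < p := by linarith
  obtain ⟨v, hvC, hv1, hv2, hv3, hv4, hv5⟩ := exists_truncation hop hu huc hu0 hM hmax
    (c := u x / (p * ε ^ 2)) (by positivity) (fun y hy => (abs_le.1 (hlap y hy)).1)
    (δ := u x / p) (by positivity)
  have hvx : 1 - 3 / p ≤ v x := by
    have h1 : u x - u x / p = u x * (1 - 1 / p) := by ring
    have h2 : 0 ≤ 1 - 1 / p := by
      rw [sub_nonneg, div_le_one hp0]
      exact hp.le
    rw [hv1 x hx, h1, max_eq_left (by positivity), mul_pow, mul_div_cancel_left₀ _ (by positivity)]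
    have h3 : 3 / p = 3 * (1 / p) := by ring
    have h4 : 0 < 1 / p := by positivity
    rw [h3]
    nlinarith [mul_nonneg (sq_nonneg (1 / p)) h2, sq_nonneg (1 / p)]
  refine ⟨v, hvC, fun y => ?_, hv2, fun ρ hρ => ?_, hv4, hv5⟩
  · by_cases hy : y ∈ Ω
    · rw [hv1 y hy, div_le_one (by positivity)]
      refine pow_le_pow_left₀ (le_max_right _ _) (max_le ?_ hM.le) 3
      have : 0 < u x / p := by positivity
      linarith [hmax y hy]
    · rw [hv2 y hy]
      exact zero_le_one
  · have hI := integral_wt_pos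
    have h1 := mul_integral_wt_le hvC (x := x) hρ (c := 3 * (u x / (p * ε ^ 2)) / u x)
      (by positivity) fun y _ => hv3 y
    have h2 : ∫ z, (1 - v (x + ρ • z)) * wt z = (∫ z, wt z) - ∫ z, v (x + ρ • z) * wt z := by
      have hvc : Continuous fun z => v (x + ρ • z) := hvC.continuous.comp (by fun_prop)
      rw [← integral_sub integrable_wt (integrable_mul_wt hvc)]
      exact integral_congr_ae (Eventually.of_forall fun z => by simp only; ring)
    have h3 : 3 * (u x / (p * ε ^ 2)) / u x * ρ ^ 2 = 3 / p * (ρ ^ 2 / ε ^ 2) := by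
      field_simp
    rw [h3] at h1
    have h4 : ∫ z, (1 - v (x + ρ • z)) * wt z ≤ 3 / p * (1 + ρ ^ 2 / ε ^ 2) * ∫ z, wt z := by
      rw [h2]
      nlinarith [mul_le_mul_of_nonneg_right hvx hI.le]
    calc _ ≤ p * (3 / p * (1 + ρ ^ 2 / ε ^ 2) * ∫ z, wt z) :=
          mul_le_mul_of_nonneg_left h4 hp0.le
      _ = _ := by field_simp

/-- The mass of the weight away from the center. -/
def outerMass : ℝ := ∫ z, {z : R2 | 1 / 2 ≤ ‖z‖}.indicator wt z

lemma measurableSet_outer : MeasurableSet {z : R2 | 1 / 2 ≤ ‖z‖} :=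
  (isClosed_le continuous_const continuous_norm).measurableSet

lemma outerMass_pos : 0 < outerMass := by
  unfold outerMass
  rw [integral_indicator measurableSet_outer,
    setIntegral_pos_iff_support_of_nonneg_ae (Eventually.of_forall fun z => wt_nonneg z)
      integrable_wt.integrableOn]
  have hopen : IsOpen {z : R2 | 1 / 2 < ‖z‖ ∧ ‖z‖ < 1} :=
    (isOpen_lt continuous_const continuous_norm).inter (isOpen_lt continuous_norm continuous_const)
  refine (hopen.measure_pos volume ⟨EuclideanSpace.single 0 (3 / 4), ?_⟩).trans_le
    (measure_mono ?_)
  · simp only [mem_ofPred_eq, PiLp.norm_single]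
    norm_num
  · rintro z ⟨hz1, hz2⟩
    refine ⟨?_, hz1.le⟩
    have : 0 < 1 - ‖z‖ ^ 2 := by nlinarith [norm_nonneg z]
    simp only [Function.mem_support, wt, ne_eq]
    rw [max_eq_left this.le]
    positivity

/-- Upper bound on the concentration scale. -/
lemma mul_sq_scale_le {Ω : Set R2} {x : R2} {v : R2 → ℝ} {p ε D : ℝ}
    (hε : 0 < ε) (hD : 0 < D) (hΩ : Ω ⊆ ball x D) (hv : Continuous v) (hv1 : ∀ y, v y ≤ 1)
    (hv0 : ∀ y ∉ Ω, v y = 0) (hp : 0 < p) (hp' : 6 * (∫ z, wt z) ≤ p * outerMass)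
    (h : p * ∫ z, (1 - v (x + (2 * D) • z)) * wt z ≤
      3 * (1 + (2 * D) ^ 2 / ε ^ 2) * ∫ z, wt z) :
    p * ε ^ 2 ≤ 24 * D ^ 2 * (∫ z, wt z) / outerMass := by
  have h1 : outerMass ≤ ∫ z, (1 - v (x + (2 * D) • z)) * wt z := by
    refine integral_mono (integrable_wt.indicator measurableSet_outer)
      (integrable_mul_wt (by fun_prop)) fun z => ?_
    by_cases hz : 1 / 2 ≤ ‖z‖
    · have : x + (2 * D) • z ∉ Ω := fun hmem => by
        have := hΩ hmem
        rw [mem_ball, dist_eq_norm, add_sub_cancel_left, norm_smul,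
          Real.norm_of_nonneg (by positivity)] at this
        nlinarith
      rw [indicator_of_mem (show z ∈ {z : R2 | 1 / 2 ≤ ‖z‖} from hz)]
      simp [hv0 _ this]
    · rw [indicator_of_notMem (show z ∉ {z : R2 | 1 / 2 ≤ ‖z‖} from hz)]
      exact mul_nonneg (sub_nonneg.2 (hv1 _)) (wt_nonneg _)
  have h2 : p * outerMass ≤ 3 * (1 + (2 * D) ^ 2 / ε ^ 2) * ∫ z, wt z :=
    (mul_le_mul_of_nonneg_left h1 hp.le).trans h
  have h3 : p * outerMass ≤ 24 * D ^ 2 * (∫ z, wt z) / ε ^ 2 := by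
    have : 3 * (1 + (2 * D) ^ 2 / ε ^ 2) * (∫ z, wt z) =
      3 * (∫ z, wt z) + (24 * D ^ 2 * (∫ z, wt z) / ε ^ 2) / 2 := by ring
    linarith
  rw [le_div_iff₀ (by positivity)] at h3
  rw [le_div_iff₀ outerMass_pos]
  linarith

/-- If the maximum point is too close to the boundary, the Dirichlet energy is large. -/
lemma mul_le_of_near_frontier {Ω : Set R2} (hop : IsOpen Ω) {u v : R2 → ℝ} {x q : R2}
    {p ε κ r K : ℝ} (hp : 0 < p) (hε : 0 < ε) (hκ : 0 < κ) (hK : 0 < K) (hεr : ε ≤ r)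
    (hM : 1 / 2 ≤ u x) (hvC : ContDiff ℝ 2 v) (hv1 : ∀ y, v y ≤ 1) (hv0 : ∀ y ∉ Ω, v y = 0)
    (hmean : ∀ ρ : ℝ, 0 ≤ ρ → p * ∫ z, (1 - v (x + ρ • z)) * wt z ≤
        3 * (1 + ρ ^ 2 / ε ^ 2) * ∫ z, wt z)
    (hd : ∀ y ∈ Ω, ‖fderiv ℝ v y‖ ≤ 3 / u x * ‖fderiv ℝ u y‖)
    (hd0 : ∀ y ∉ Ω, fderiv ℝ v y = 0)
    (hint : IntegrableOn (fun y => ‖gradient u y‖ ^ 2) Ω) (hqx : dist q x ≤ κ * ε) (e : R2 ≃ᵢ R2)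
    (he : ∀ t : ℝ, |t - e q 0| ≤ r →
      ∃ y : ℝ, |y - e q 1| ≤ K * |t - e q 0| ∧ e.symm !₂[t, y] ∈ frontier Ω) :
    3 * K * p ≤ 16 / 3 * (2 * (κ + 1 + K)) ^ 2 * (1 + (2 * (κ + 1 + K)) ^ 2) * (∫ z, wt z) +
      144 * K ^ 2 * (p * ∫ y in Ω, ‖gradient u y‖ ^ 2) := by
  set m := 2 * (κ + 1 + K) with hm
  have hm0 : 0 < m := by positivity
  set S := box e (e q 0) (e q 1) ε (K * ε) with hS
  have hSc : IsCompact S := isCompact_box ..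
  have hfc : Continuous (fderiv ℝ v) := hvC.continuous_fderiv (by norm_num)
  have hI := integral_wt_pos
  have hSint {f : R2 → ℝ} (hf : Continuous f) : IntegrableOn f S :=
    hf.continuousOn.integrableOn_compact hSc
  have hSball : ∀ y ∈ S, dist y x ≤ m * ε / 2 := fun y hy => by
    have h1 : dist y q ≤ ε + K * ε := by
      rw [← e.dist_eq, dist_eq_norm]
      refine (norm_le_abs_add_abs _).trans ?_
      obtain ⟨⟨h1, h2⟩, h3, h4⟩ := hy
      refine add_le_add (abs_le.2 ?_) (abs_le.2 ?_)
      · rw [PiLp.sub_apply]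
        exact ⟨by linarith, by linarith⟩
      · rw [PiLp.sub_apply]
        exact ⟨by linarith, by linarith⟩
    have := dist_triangle y q x
    rw [hm]
    linarith
  have hdefect : p * ∫ y in S, (1 - v y) ≤ ε ^ 2 * (16 / 3 * m ^ 2 * (1 + m ^ 2) * ∫ z, wt z) := by
    have hρ : 0 < m * ε := by positivity
    have hnn : ∀ y, 0 ≤ (1 - v y) * wt ((m * ε)⁻¹ • (y - x)) := fun y =>
      mul_nonneg (sub_nonneg.2 (hv1 y)) (wt_nonneg _)
    have hi : Integrable fun y => 16 / 9 * ((1 - v y) * wt ((m * ε)⁻¹ • (y - x))) :=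
      (integrable_mul_wt_rescale (continuous_const.sub hvC.continuous) x hρ).const_mul _
    have h1 : ∫ y in S, (1 - v y) ≤ 16 / 9 * ((m * ε) ^ 2 *
        ∫ z, (1 - v (x + (m * ε) • z)) * wt z) := by
      rw [← integral_comp_mul_wt (fun y => 1 - v y) x hρ, ← integral_const_mul]
      calc ∫ y in S, (1 - v y)
          ≤ ∫ y in S, 16 / 9 * ((1 - v y) * wt ((m * ε)⁻¹ • (y - x))) := by
            refine setIntegral_mono_on (hSint (continuous_const.sub hvC.continuous))
              hi.integrableOn hSc.measurableSet fun y hy => ?_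
            have : 9 / 16 ≤ wt ((m * ε)⁻¹ • (y - x)) := by
              refine le_wt ?_
              rw [norm_smul, norm_inv, Real.norm_of_nonneg hρ.le, inv_mul_le_iff₀ hρ,
                ← dist_eq_norm]
              linarith [hSball y hy]
            nlinarith [hv1 y]
        _ ≤ ∫ y, 16 / 9 * ((1 - v y) * wt ((m * ε)⁻¹ • (y - x))) :=
            setIntegral_le_integral hi (Eventually.of_forall fun y =>
              mul_nonneg (by norm_num) (hnn y))
    calc p * ∫ y in S, (1 - v y) ≤ p * (16 / 9 * ((m * ε) ^ 2 *
        ∫ z, (1 - v (x + (m * ε) • z)) * wt z)) := mul_le_mul_of_nonneg_left h1 hp.le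
      _ = 16 / 9 * (m * ε) ^ 2 * (p * ∫ z, (1 - v (x + (m * ε) • z)) * wt z) := by ring
      _ ≤ 16 / 9 * (m * ε) ^ 2 * (3 * (1 + (m * ε) ^ 2 / ε ^ 2) * ∫ z, wt z) :=
          mul_le_mul_of_nonneg_left (hmean _ hρ.le) (by positivity)
      _ = _ := by
          field_simp
          ring
  have hsum : (∫ y in S, v y) + ∫ y in S, (1 - v y) = 4 * ε * (K * ε) := by
    have h1v : Continuous fun y => 1 - v y := continuous_const.sub hvC.continuous
    rw [← integral_add (hSint hvC.continuous) (hSint h1v)]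
    simp only [add_sub_cancel]
    rw [setIntegral_box_const e _ _ _ hε.le (by positivity), mul_one]
  have hpoinc := setIntegral_box_le e (a := e q 0) (b := e q 1) hε (show 0 < K * ε by positivity)
    (hvC.of_le (by norm_num)) (fun t ht => by
      have ht' : |t - e q 0| ≤ ε := abs_le.2 ⟨by linarith [ht.1], by linarith [ht.2]⟩
      obtain ⟨y, hy, hy'⟩ := he t (ht'.trans hεr)
      have hy2 := abs_le.1 (hy.trans (mul_le_mul_of_nonneg_left ht' hK.le))
      refine ⟨y, ⟨by linarith, by linarith⟩, hv0 _ fun hmem => ?_⟩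
      exact hy'.2 (by rwa [hop.interior_eq]))
  have henergy : ∫ y in S, ‖fderiv ℝ v y‖ ^ 2 ≤ 36 * ∫ y in Ω, ‖gradient u y‖ ^ 2 := by
    have hgr : ∀ y, ‖gradient u y‖ = ‖fderiv ℝ u y‖ := fun y => by
      simp [gradient]
    have hpt : ∀ y, ‖fderiv ℝ v y‖ ^ 2 ≤ Ω.indicator (fun y => 36 * ‖gradient u y‖ ^ 2) y := by
      intro y
      by_cases hy : y ∈ Ω
      · rw [indicator_of_mem hy, hgr]
        have h1 : 3 / u x ≤ 6 := by
          rw [div_le_iff₀ (by linarith)]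
          linarith
        have h2 : ‖fderiv ℝ v y‖ ≤ 6 * ‖fderiv ℝ u y‖ :=
          (hd y hy).trans (mul_le_mul_of_nonneg_right h1 (norm_nonneg _))
        have h3 := pow_le_pow_left₀ (norm_nonneg _) h2 2
        linarith
      · simp [hy, hd0 y hy]
    have hi : Integrable (Ω.indicator fun y => 36 * ‖gradient u y‖ ^ 2) :=
      (integrable_indicator_iff hop.measurableSet).2 (hint.const_mul 36)
    rw [← integral_const_mul, ← integral_indicator hop.measurableSet]
    calc ∫ y in S, ‖fderiv ℝ v y‖ ^ 2
        ≤ ∫ y in S, Ω.indicator (fun y => 36 * ‖gradient u y‖ ^ 2) y :=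
          setIntegral_mono (hSint (hfc.norm.pow 2)) hi.integrableOn hpt
      _ ≤ _ := setIntegral_le_integral hi (Eventually.of_forall fun y =>
          (sq_nonneg _).trans (hpt y))
  refine le_of_mul_le_mul_left ?_ (show 0 < ε ^ 2 by positivity)
  have h1 : 3 * K * ε ^ 2 ≤ (∫ y in S, (1 - v y)) +
      144 * K ^ 2 * ε ^ 2 * ∫ y in Ω, ‖gradient u y‖ ^ 2 := by
    have : 4 * (K * ε) ^ 2 * ∫ y in S, ‖fderiv ℝ v y‖ ^ 2 ≤
        4 * (K * ε) ^ 2 * (36 * ∫ y in Ω, ‖gradient u y‖ ^ 2) :=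
      mul_le_mul_of_nonneg_left henergy (by positivity)
    linarith
  have h2 := mul_le_mul_of_nonneg_left h1 hp.le
  linarith

theorem stmt9
    (Ω : Set R2) (hne : Ω.Nonempty) (hop : IsOpen Ω)
    (hbdd : Bornology.IsBounded Ω) (hconn : IsConnected Ω) (hsm : SmoothBoundary Ω)
    (u : ℝ → R2 → ℝ)
    (hsol : ∀ p > (1:ℝ), IsSolution Ω p (u p))
    (hnod : ∀ p > (1:ℝ), IsNodal Ω (u p))
    (xp xm : ℝ → R2)
    (hxpmem : ∀ p > (1:ℝ), xp p ∈ Ω)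
    (hxpmax : ∀ p > (1:ℝ), ∀ x ∈ Ω, u p x ≤ u p (xp p))
    (hxmmem : ∀ p > (1:ℝ), xm p ∈ Ω)
    (hxmmin : ∀ p > (1:ℝ), ∀ x ∈ Ω, u p (xm p) ≤ u p x)
    (hcomp : ∀ p > (1:ℝ), -u p (xm p) ≤ u p (xp p))
    (hA : CondA Ω u) :
    Tendsto (fun p : ℝ => Metric.infDist (xp p) {x ∈ Ω | u p x = 0} / eps u xp p)
      atTop atTop := by
  rw [Filter.tendsto_atTop]
  intro b
  obtain ⟨r, hr, L, hL, hgraph⟩ := exists_uniform_graph hbdd hsm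
  set K := max b 1 with hK
  have hK1 : 1 ≤ K := le_max_right _ _
  set I := ∫ z, wt z with hI
  have hI0 : 0 < I := integral_wt_pos
  have hm0 := outerMass_pos
  set D := diam Ω + 1 with hD
  have hD0 : 0 < D := by have := diam_nonneg (s := Ω); linarith
  set C := 24 * D ^ 2 * I / outerMass with hC
  have hC0 : 0 < C := by positivity
  set E := 16 * π * Real.exp 1 with hE
  have hE0 : 0 < E := by positivity
  set B := 16 / 3 * (2 * (5 * K + 1 + L)) ^ 2 * (1 + (2 * (5 * K + 1 + L)) ^ 2) * I +
      144 * L ^ 2 * (E + 1) with hB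
  have hhalf : Tendsto (fun p : ℝ => (1 / 2 : ℝ) ^ (p - 1)) atTop (𝓝 0) :=
    (tendsto_rpow_atTop_of_base_lt_one (1 / 2) (by norm_num) (by norm_num)).comp
      (tendsto_atTop_add_const_right _ (-1) tendsto_id)
  filter_upwards [eventually_gt_atTop 1, eventually_gt_atTop (500 * K ^ 2),
    eventually_gt_atTop (B / (3 * L)), eventually_ge_atTop (6 * I / outerMass),
    eventually_ge_atTop (C / r ^ 2), hhalf.eventually (gt_mem_nhds (show 0 < 1 / C by positivity)),
    hA.eventually (lt_mem_nhds hE0), hA.eventually (gt_mem_nhds (lt_add_one E))]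
    with p hp1 hp2 hp3 hp4 hp5 hp6 hp7 hp8
  have hp0 : 0 < p := by linarith
  obtain ⟨hu2, hu1, heq, hu0⟩ := hsol p hp1
  obtain ⟨⟨y₁, hy₁, hy₁'⟩, y₂, hy₂, hy₂'⟩ := hnod p hp1
  have hx := hxpmem p hp1
  have hmax := hxpmax p hp1
  have hM : 0 < u p (xp p) := hy₁'.trans_le (hmax y₁ hy₁)
  have hMp : 0 < u p (xp p) ^ (p - 1) := Real.rpow_pos_of_pos hM _
  set x := xp p with hxdef
  set ε := eps u xp p with hεdef
  have hε : 0 < ε := by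
    rw [hεdef, eps]
    positivity
  have hεM : u p x ^ (p - 1) = 1 / (p * ε ^ 2) := by
    rw [hεdef, eps, ← hxdef, div_pow, Real.sq_sqrt (by positivity)]
    field_simp
  have hlap : ∀ y ∈ Ω, |lap (u p) y| ≤ u p x / (p * ε ^ 2) := fun y hy => by
    have h1 : |u p y| ≤ u p x :=
      abs_le.2 ⟨by linarith [hcomp p hp1, hxmmin p hp1 y hy], hmax y hy⟩
    have h2 : |u p y| ^ (p - 1) ≤ u p x ^ (p - 1) :=
      Real.rpow_le_rpow (abs_nonneg _) h1 (by linarith)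
    rw [← abs_neg, heq y hy, abs_mul, abs_of_nonneg (Real.rpow_nonneg (abs_nonneg _) _),
      div_eq_mul_one_div, ← hεM, mul_comm (u p x)]
    exact mul_le_mul h2 h1 (abs_nonneg _) hMp.le
  obtain ⟨v, hvC, hv1, hv0, hmean, hd, hd0⟩ := exists_profile hop hu2 hu1.continuousOn hu0 hx hp1
    hε hM hmax hlap
  have hscale : p * ε ^ 2 ≤ C := by
    refine mul_sq_scale_le hε hD0 (fun y hy => ?_) hvC.continuous hv1 hv0 hp0 ?_
      (hmean _ (by positivity))
    · rw [mem_ball, hD]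
      linarith [dist_le_diam_of_mem hbdd hy hx]
    · rwa [div_le_iff₀ hm0] at hp4
  have hMhalf : 1 / 2 ≤ u p x := by
    by_contra! hlt
    have h1 : u p x ^ (p - 1) ≤ (1 / 2) ^ (p - 1) :=
      Real.rpow_le_rpow hM.le hlt.le (by linarith)
    have h2 : 1 / C ≤ 1 / (p * ε ^ 2) := one_div_le_one_div_of_le (by positivity) hscale
    linarith
  have hεr : ε ≤ r := by
    rw [div_le_iff₀ (by positivity)] at hp5
    have : ε ^ 2 ≤ r ^ 2 := le_of_mul_le_mul_left (hscale.trans hp5) hp0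
    exact le_of_sq_le_sq this hr.le
  have hint : IntegrableOn (fun y => ‖gradient (u p) y‖ ^ 2) Ω := by
    by_contra hni
    rw [integral_undef hni, mul_zero] at hp7
    exact lt_irrefl _ hp7
  have hball : closedBall x (5 * (K * ε)) ⊆ Ω := by
    by_contra hnot
    obtain ⟨w, hw, hwΩ⟩ := not_subset.1 hnot
    obtain ⟨q, hq, hqf⟩ := (convex_closedBall x (5 * (K * ε))).isPreconnected.inter_frontier_nonempty_of_isOpen hop
      ⟨x, mem_closedBall_self (by positivity), hx⟩ ⟨w, hw, hwΩ⟩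
    obtain ⟨e, he⟩ := hgraph q hqf
    have h1 := mul_le_of_near_frontier hop hp0 hε (κ := 5 * K) (by positivity) hL hεr hMhalf hvC
      hv1 hv0 hmean hd hd0 hint (by rw [mem_closedBall] at hq; linarith) e he
    have h2 : 144 * L ^ 2 * (p * ∫ y in Ω, ‖gradient (u p) y‖ ^ 2) ≤ 144 * L ^ 2 * (E + 1) :=
      mul_le_mul_of_nonneg_left hp8.le (by positivity)
    rw [div_lt_iff₀ (by positivity)] at hp3
    linarith
  have hNL : {y ∈ Ω | u p y = 0}.Nonempty := by
    obtain ⟨y, hy, hy0⟩ := hconn.isPreconnected.intermediate_value hy₂ hy₁ hu2.continuousOn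
      ⟨hy₂'.le, hy₁'.le⟩
    exact ⟨y, hy, hy0⟩
  refine (le_max_left b 1).trans ?_
  rw [le_div_iff₀ hε]
  by_contra! hlt
  obtain ⟨y, ⟨hyΩ, hy0⟩, hy⟩ := (infDist_lt_iff hNL).1 hlt
  have h1 := sub_le_of_ball_subset hop hu2 (show 0 < K * ε by positivity)
    (c := u p x / (p * ε ^ 2)) (by positivity) hmax hlap hball (by rw [dist_comm]; exact hy.le)
  rw [hy0, sub_zero, show 500 * (u p x / (p * ε ^ 2)) * (K * ε) ^ 2 = 500 * K ^ 2 * u p x / p by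
    field_simp, le_div_iff₀ hp0] at h1
  nlinarith
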